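/- (L^p → L^q bound, Lipschitz case.) Let 0 < β ≤ 1 and 0 ≤ δ < n with β + δ < n, let 1 < p < n/(β + δ) and 1/q = 1/p − (β + δ)/n. Let T and T^A be as in the context, assume T is bounded from L^r(R^n) to L^s(R^n) for every 1 < r < n/δ with 1/s = 1/r − δ/n, and suppose D^α A ∈ Lip_β(R^n) for every multi-index α with |α| = m. Then there is a constant C such that ‖T^A f‖_{L^q} ≤ C Σ_{|α| = m} ‖D^α A‖_{Lip_β} ‖f‖_{L^p} for all bounded compactly supported f. -/

import Mathlib

open MeasureTheory ENNReal

noncomputable section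

/-- Euclidean space `ℝⁿ`. -/
abbrev En (n : ℕ) := EuclideanSpace ℝ (Fin n)

/-- The closed cube with center `c` and side length `s`, sides parallel to the axes. -/
def cube {n : ℕ} (c : En n) (s : ℝ) : Set (En n) := {y : En n | ∀ i, |y i - c i| ≤ s / 2}

/-- The average of `b` over the cube `Q(c, s)`. -/
def cubeAvg {n : ℕ} (b : En n → ℝ) (c : En n) (s : ℝ) : ℝ :=
  (volume (cube c s)).toReal⁻¹ * ∫ y in cube c s, b y

/-- `B` is an upper bound for the BMO norm of `b`. -/
def BMOBound {n : ℕ} (b : En n → ℝ) (B : ℝ) : Prop :=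
  ∀ (c : En n) (s : ℝ), 0 < s →
    ∫ y in cube c s, |b y - cubeAvg b c s| ≤ B * (volume (cube c s)).toReal

/-- `B` is an admissible `BMO_φ` constant for `b`:
`|Q(c,s)|⁻¹ ∫_{Q(c,s)} |b − b_Q| ≤ B φ(s)` for every cube. -/
def BMOphiBound {n : ℕ} (φ : ℝ → ℝ) (b : En n → ℝ) (B : ℝ) : Prop :=
  ∀ (c : En n) (s : ℝ), 0 < s →
    ∫ y in cube c s, |b y - cubeAvg b c s| ≤ B * φ s * (volume (cube c s)).toReal

/-- `L` is an upper bound for the `Lip_β` seminorm of `b`. -/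
def LipBound {n : ℕ} (β : ℝ) (b : En n → ℝ) (L : ℝ) : Prop :=
  ∀ x y : En n, |b x - b y| ≤ L * ‖x - y‖ ^ β

/-- First-order partial derivative in the `i`-th coordinate direction. -/
def pderivFun {n : ℕ} (i : Fin n) (f : En n → ℝ) : En n → ℝ :=
  fun x => fderiv ℝ f x (EuclideanSpace.single i 1)

/-- Iterated partial derivative `D^α f` for a multi-index `α`. -/
def iterPDeriv {n : ℕ} (α : Fin n → ℕ) (f : En n → ℝ) : En n → ℝ :=
  ((List.finRange n).foldr (fun i g => (pderivFun i)^[α i] ∘ g) id) f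

/-- `g` is the distributional (weak) derivative `D^α A`. -/
def IsWeakDeriv {n : ℕ} (α : Fin n → ℕ) (A g : En n → ℝ) : Prop :=
  ∀ φ : En n → ℝ, ContDiff ℝ (⊤ : ℕ∞) φ → HasCompactSupport φ →
    ∫ x, A x * iterPDeriv α φ x = (-1 : ℝ) ^ (∑ i, α i) * ∫ x, g x * φ x

/-- The Taylor remainder `R_m(A; x, y) = A(x) − ∑_{|α| ≤ m−1} (1/α!) D^α A(y) (x−y)^α`,
where `DA α` denotes `D^α A`. -/
def Rm {n : ℕ} (m : ℕ) (A : En n → ℝ) (DA : (Fin n → ℕ) → En n → ℝ) (x y : En n) : ℝ :=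
  A x - ∑ k ∈ Finset.range m, ∑ α ∈ Finset.Nat.antidiagonalTuple n k,
    ((∏ i, Nat.factorial (α i) : ℕ) : ℝ)⁻¹ * DA α y * ∏ i, (x i - y i) ^ α i

/-- The multilinear operator `T^A f(x) = ∫ (R_{m+1}(A;x,y)/|x−y|^m) K(x,y) f(y) dy`. -/
def TA {n : ℕ} (m : ℕ) (A : En n → ℝ) (DA : (Fin n → ℕ) → En n → ℝ)
    (K : En n → En n → ℝ) (f : En n → ℝ) (x : En n) : ℝ :=
  ∫ y, Rm (m + 1) A DA x y / ‖x - y‖ ^ m * (K x y * f y)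

/-- The integral operator `T f(x) = ∫ K(x,y) f(y) dy`. -/
def Tint {n : ℕ} (K : En n → En n → ℝ) (f : En n → ℝ) (x : En n) : ℝ := ∫ y, K x y * f y

/-- A bounded, measurable, compactly supported function. -/
def NiceFun {n : ℕ} (f : En n → ℝ) : Prop :=
  Measurable f ∧ HasCompactSupport f ∧ ∃ M : ℝ, ∀ x, |f x| ≤ M

/-- The Orlicz "norm" `‖f‖_{L_ψ} = inf_{λ>0} λ⁻¹ (1 + ∫ ψ(λ|f|))`. -/
def orliczNorm {n : ℕ} (ψ : ℝ → ℝ) (f : En n → ℝ) : ℝ≥0∞ :=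
  ⨅ (l : ℝ) (_ : 0 < l),
    ENNReal.ofReal l⁻¹ * (1 + ∫⁻ x, ENNReal.ofReal (ψ (l * |f x|)))

/-- The fractional maximal function
`M_{δ,r} f(x) = sup_{Q ∋ x} (|Q|^{−(1−rδ/n)} ∫_Q |f|^r)^{1/r}`. -/
def Mfrac {n : ℕ} (δ r : ℝ) (f : En n → ℝ) (x : En n) : ℝ≥0∞ :=
  ⨆ (c : En n) (s : ℝ) (_ : 0 < s ∧ x ∈ cube c s),
    (((volume (cube c s)) ^ (1 - r * δ / n))⁻¹ *
      ∫⁻ y in cube c s, (ENNReal.ofReal |f y|) ^ r) ^ (1 / r)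

/-- The sharp maximal function `g♯(x) = sup_{Q ∋ x} |Q|⁻¹ ∫_Q |g − g_Q|`. -/
def sharpFn {n : ℕ} (g : En n → ℝ) (x : En n) : ℝ≥0∞ :=
  ⨆ (c : En n) (s : ℝ) (_ : 0 < s ∧ x ∈ cube c s),
    (volume (cube c s))⁻¹ * ∫⁻ y in cube c s, ENNReal.ofReal |g y - cubeAvg g c s|

/-- The distribution function `m_g(s) = |{x : |g(x)| > s}|`. -/
def distrib {n : ℕ} (g : En n → ℝ) (s : ℝ) : ℝ≥0∞ := volume {x : En n | s < |g x|}


section Maximal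
open Set Metric



/-- Centered maximal function. -/
def HLM {n : ℕ} (F : En n → ℝ≥0∞) (x : En n) : ℝ≥0∞ :=
  ⨆ (r : ℝ) (_ : 0 < r), (volume (ball x r))⁻¹ * ∫⁻ y in ball x r, F y

lemma vol_ball_ne_zero {n : ℕ} (x : En n) {r : ℝ} (hr : 0 < r) : volume (ball x r) ≠ 0 :=
  (measure_ball_pos volume x hr).ne'

lemma vol_ball_ne_top {n : ℕ} (x : En n) (r : ℝ) : volume (ball x r) ≠ ⊤ :=
  measure_ball_lt_top.ne

lemma vol_ball_mul {n : ℕ} (x : En n) {s : ℝ} (hs : 0 < s) (r : ℝ) :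
    volume (ball x (s * r)) = ENNReal.ofReal (s ^ n) * volume (ball x r) := by
  have := Measure.addHaar_ball_mul_of_pos (volume : Measure (En n)) x hs r
  rw [this, ← Measure.addHaar_ball_center (volume : Measure (En n)) x r]
  simp

lemma HLM_lt_iff {n : ℕ} (F : En n → ℝ≥0∞) (x : En n) (s : ℝ≥0∞) :
    s < HLM F x ↔ ∃ r, 0 < r ∧ s * volume (ball x r) < ∫⁻ y in ball x r, F y := by
  unfold HLM
  simp only [lt_iSup_iff, exists_prop]
  refine exists_congr fun r => and_congr_right fun hr => ?_
  rw [mul_comm _ (∫⁻ y in ball x r, F y), ← div_eq_mul_inv, ENNReal.lt_div_iff_mul_lt]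
  · exact Or.inl (vol_ball_ne_zero x hr)
  · exact Or.inl (vol_ball_ne_top x r)

lemma HLM_measurable {n : ℕ} {F : En n → ℝ≥0∞} (hF : Measurable F) : Measurable (HLM F) := by
  refine measurable_of_Ioi fun s => IsOpen.measurableSet ?_
  rw [Metric.isOpen_iff]
  intro x hx
  obtain ⟨r, hr, h⟩ := (HLM_lt_iff F x s).1 hx
  set ν := (volume : Measure (En n)).withDensity F
  have hν : ∀ (y : En n) (r : ℝ), ∫⁻ z in ball y r, F z = ν (ball y r) := fun y r =>
    (withDensity_apply F measurableSet_ball).symm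
  have hU : ball x r = ⋃ k : ℕ, ball x (r - 1 / ((k : ℝ) + 1)) := by
    ext y
    simp only [mem_ball, mem_iUnion]
    constructor
    · intro hy
      obtain ⟨k, hk⟩ := exists_nat_one_div_lt (sub_pos.2 hy)
      exact ⟨k, by linarith⟩
    · rintro ⟨k, hk⟩
      have : (0:ℝ) < 1 / ((k : ℝ) + 1) := by positivity
      linarith
  have hmono : Monotone fun k : ℕ => ball x (r - 1 / ((k : ℝ) + 1)) := by
    intro a b hab
    refine ball_subset_ball ?_
    have : 1 / ((b : ℝ) + 1) ≤ 1 / ((a : ℝ) + 1) := by gcongr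
    linarith
  have hνU : ν (ball x r) = ⨆ k : ℕ, ν (ball x (r - 1 / ((k : ℝ) + 1))) := by
    rw [hU, hmono.directed_le.measure_iUnion]
  rw [hν, hνU, lt_iSup_iff] at h
  obtain ⟨k, hk⟩ := h
  refine ⟨1 / ((k : ℝ) + 1), by positivity, fun y hy => ?_⟩
  refine (HLM_lt_iff F y s).2 ⟨r, hr, ?_⟩
  rw [hν]
  have e : volume (ball y r) = volume (ball x r) := by
    rw [Measure.addHaar_ball_center, ← Measure.addHaar_ball_center _ x]
  rw [e]
  refine hk.trans_le (measure_mono (ball_subset_ball' ?_))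
  rw [dist_comm]; rw [mem_ball] at hy; linarith

lemma HLM_weak {n : ℕ} (hn : 0 < n) {F : En n → ℝ≥0∞} 
    (hfin : ∫⁻ y, F y ≠ ⊤) {s : ℝ} (hs : 0 < s) :
    ENNReal.ofReal s * volume {x | ENNReal.ofReal s < HLM F x} ≤
      ENNReal.ofReal (5 ^ n) * ∫⁻ y, F y := by
  set S := {x | ENNReal.ofReal s < HLM F x}
  have hS : ∀ x, x ∈ S → ∃ r, 0 < r ∧
      ENNReal.ofReal s * volume (ball x r) < ∫⁻ y in ball x r, F y := fun x hx =>
    (HLM_lt_iff F x _).1 hx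
  choose! r hr hlt using hS
  -- radius bound
  obtain ⟨R, hR⟩ : ∃ R : ℝ, ∀ a ∈ S, r a ≤ R := by
    set I := ∫⁻ y, F y
    set V := volume (ball (0 : En n) 1)
    have hV0 : V ≠ 0 := vol_ball_ne_zero _ one_pos
    have hVt : V ≠ ⊤ := vol_ball_ne_top _ _
    have hVpos : 0 < V.toReal := ENNReal.toReal_pos hV0 hVt
    refine ⟨max 1 (I.toReal / (s * V.toReal)), fun a ha => ?_⟩
    by_contra! hc
    have h1 : 1 < r a := lt_of_le_of_lt (le_max_left _ _) hc
    have h2 : I.toReal / (s * V.toReal) < r a := lt_of_le_of_lt (le_max_right _ _) hc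
    have h3 := (hlt a ha).trans_le (setLIntegral_le_lintegral _ F)
    have h4 : volume (ball a (r a)) = ENNReal.ofReal (r a ^ n) * V := by
      have := vol_ball_mul a (hr a ha) 1
      rw [mul_one] at this
      rw [this, Measure.addHaar_ball_center]
    rw [h4] at h3
    have h5 := (ENNReal.toReal_lt_toReal (ne_top_of_lt h3) hfin).2 h3
    have hra := hr a ha
    rw [toReal_mul, toReal_mul, toReal_ofReal hs.le, toReal_ofReal (by positivity)] at h5
    rw [div_lt_iff₀ (by positivity)] at h2
    have h6 : r a ≤ r a ^ n := le_self_pow₀ h1.le hn.ne'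
    have : r a * (s * V.toReal) ≤ s * (r a ^ n * V.toReal) := by
      have := mul_le_mul_of_nonneg_right h6 (by positivity : 0 ≤ s * V.toReal)
      linarith
    change _ < I.toReal at h5
    linarith
  obtain ⟨u, huS, hdisj, hcov⟩ :=
    Vitali.exists_disjoint_subfamily_covering_enlargement_ball S (fun x => x) r R hR 5 (by norm_num)
  have hcount : u.Countable := by
    refine hdisj.countable_of_isOpen (fun _ _ => isOpen_ball) fun a ha => ?_
    exact ⟨a, mem_ball_self (hr a (huS ha))⟩
  have hsub : S ⊆ ⋃ b ∈ u, ball b (5 * r b) := by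
    intro a ha
    obtain ⟨b, hb, h⟩ := hcov a ha
    exact mem_biUnion hb (h (mem_ball_self (hr a ha)))
  calc ENNReal.ofReal s * volume S
      ≤ ENNReal.ofReal s * ∑' b : u, volume (ball (b : En n) (5 * r b)) := by
        gcongr
        exact (measure_mono hsub).trans (measure_biUnion_le _ hcount _)
    _ = ENNReal.ofReal (5 ^ n) * ∑' b : u, ENNReal.ofReal s * volume (ball (b : En n) (r b)) := by
        simp_rw [vol_ball_mul _ (by norm_num : (0:ℝ) < 5), ENNReal.tsum_mul_left]
        ring
    _ ≤ ENNReal.ofReal (5 ^ n) * ∑' b : u, ∫⁻ y in ball (b : En n) (r b), F y := by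
        gcongr with b
        exact (hlt b (huS b.2)).le
    _ = ENNReal.ofReal (5 ^ n) * ∫⁻ y in ⋃ b ∈ u, ball b (r b), F y := by
        rw [lintegral_biUnion hcount (fun _ _ => measurableSet_ball) hdisj]
    _ ≤ _ := by gcongr; exact Measure.restrict_le_self

lemma HLM_le_const {n : ℕ} {F : En n → ℝ≥0∞} {B : ℝ≥0∞} (h : ∀ x, F x ≤ B) (x : En n) :
    HLM F x ≤ B := by
  refine iSup₂_le fun r hr => ?_
  calc _ ≤ (volume (ball x r))⁻¹ * ∫⁻ y in ball x r, B := by gcongr with y; exact h y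
    _ = (volume (ball x r))⁻¹ * (volume (ball x r)) * B := by
      rw [setLIntegral_const]; ring
    _ = B := by rw [ENNReal.inv_mul_cancel (vol_ball_ne_zero x hr) (vol_ball_ne_top x r), one_mul]

/-- Hardy-Littlewood maximal theorem, for bounded integrable functions. -/
lemma HLM_strong {n : ℕ} (hn : 0 < n) {p : ℝ} (hp : 1 < p) :
    ∃ C : ℝ, 0 ≤ C ∧ ∀ (f : En n → ℝ) (B : ℝ), Measurable f → (∀ x, 0 ≤ f x) → (∀ x, f x ≤ B) →
      Integrable f volume →
      ∫⁻ x, HLM (fun y => ENNReal.ofReal (f y)) x ^ p ≤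
        ENNReal.ofReal C * ∫⁻ x, ENNReal.ofReal (f x) ^ p := by
  refine ⟨p * (2 * 5 ^ n) * ((p - 1)⁻¹ * 2 ^ (p - 1)), by
    have := sub_pos.2 hp; positivity, fun f B hf h0 hB hIntg => ?_⟩
  have hp1 := sub_pos.2 hp
  set F : En n → ℝ≥0∞ := fun y => ENNReal.ofReal (f y) with hFdef
  have hF : Measurable F := hf.ennreal_ofReal
  have hMB : ∀ x, HLM F x ≤ ENNReal.ofReal B :=
    HLM_le_const fun x => ENNReal.ofReal_le_ofReal (hB x)
  have hMtop : ∀ x, HLM F x ≠ ⊤ := fun x => ne_top_of_le_ne_top ofReal_ne_top (hMB x)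
  set g : En n → ℝ := fun x => (HLM F x).toReal
  have hg : Measurable g := (HLM_measurable hF).ennreal_toReal
  have hg0 : ∀ x, 0 ≤ g x := fun x => toReal_nonneg
  set ν := (volume : Measure (En n)).withDensity F
  -- truncation
  have key : ∀ t : ℝ, 0 < t → ENNReal.ofReal t * volume {x | t < g x} ≤
      ENNReal.ofReal (2 * 5 ^ n) * ν {x | t < 2 * f x} := by
    intro t ht
    have hmeas : MeasurableSet {x | t < 2 * f x} :=
      measurableSet_lt measurable_const (hf.const_mul 2)
    set G : En n → ℝ≥0∞ := Set.indicator {x | t < 2 * f x} F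
    have hsub : {x | t < g x} ⊆ {x | ENNReal.ofReal (t / 2) < HLM G x} := by
      intro x hx
      have h1 : ENNReal.ofReal t < HLM F x := by
        rw [← ofReal_toReal (hMtop x)]
        exact (ENNReal.ofReal_lt_ofReal_iff (ht.trans hx)).2 hx
      obtain ⟨r, hr, h⟩ := (HLM_lt_iff F x _).1 h1
      refine (HLM_lt_iff G x _).2 ⟨r, hr, ?_⟩
      have h2 : ∫⁻ y in ball x r, F y ≤
          (∫⁻ y in ball x r, G y) + ENNReal.ofReal (t / 2) * volume (ball x r) := by
        rw [← setLIntegral_const, ← lintegral_add_right _ measurable_const]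
        refine lintegral_mono fun y => ?_
        by_cases hy : t < 2 * f y
        · have : G y = F y := Set.indicator_of_mem (s := {x | t < 2 * f x}) hy F
          simp [this]
        · refine le_trans ?_ le_add_self
          exact ENNReal.ofReal_le_ofReal (by linarith)
      have h3 : ENNReal.ofReal t = ENNReal.ofReal (t / 2) + ENNReal.ofReal (t / 2) := by
        rw [← ENNReal.ofReal_add (by positivity) (by positivity)]; congr 1; ring
      rw [h3, add_mul] at h
      have := h.trans_le h2
      exact lt_of_add_lt_add_right this
    have hGint : ∫⁻ y, G y = ν {x | t < 2 * f x} := by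
      rw [withDensity_apply _ hmeas, lintegral_indicator hmeas]
    have hfin : ∫⁻ y, G y ≠ ⊤ := by
      refine ne_top_of_le_ne_top (b := ∫⁻ y, F y) ?_ (lintegral_mono fun y => Set.indicator_le_self _ _ _)
      exact hIntg.lintegral_lt_top.ne
    have hw := HLM_weak hn hfin (half_pos ht)
    calc ENNReal.ofReal t * volume {x | t < g x}
        ≤ ENNReal.ofReal t * volume {x | ENNReal.ofReal (t / 2) < HLM G x} := by
          gcongr
      _ = 2 * (ENNReal.ofReal (t / 2) * volume {x | ENNReal.ofReal (t / 2) < HLM G x}) := by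
          rw [← mul_assoc]; congr 1
          rw [← ENNReal.ofReal_ofNat 2, ← ENNReal.ofReal_mul (by norm_num)]; congr 1; ring
      _ ≤ 2 * (ENNReal.ofReal (5 ^ n) * ∫⁻ y, G y) := by gcongr
      _ = _ := by
          rw [hGint, ENNReal.ofReal_mul (by norm_num), ENNReal.ofReal_ofNat]; ring
  have e1 := lintegral_rpow_eq_lintegral_meas_lt_mul volume (f := g)
    (Filter.Eventually.of_forall hg0) hg.aemeasurable (p := p) (by linarith)
  have e2 := lintegral_rpow_eq_lintegral_meas_lt_mul ν (f := fun x => 2 * f x)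
    (Filter.Eventually.of_forall fun x => by simpa using h0 x) (hf.const_mul 2).aemeasurable
    (p := p - 1) hp1
  have e3 : ∫⁻ x, HLM F x ^ p = ∫⁻ x, ENNReal.ofReal (g x ^ p) := by
    refine lintegral_congr fun x => ?_
    rw [← ENNReal.ofReal_rpow_of_nonneg (hg0 x) (by linarith), ofReal_toReal (hMtop x)]
  have e4 : ∫⁻ x, ENNReal.ofReal ((2 * f x) ^ (p - 1)) ∂ν =
      ENNReal.ofReal (2 ^ (p - 1)) * ∫⁻ x, ENNReal.ofReal (f x) ^ p := by
    rw [lintegral_withDensity_eq_lintegral_mul _ hF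
      (((hf.const_mul 2).pow_const _).ennreal_ofReal),
      ← lintegral_const_mul _ (hf.ennreal_ofReal.pow_const _)]
    refine lintegral_congr fun x => ?_
    rw [Pi.mul_apply, hFdef, Real.mul_rpow (by norm_num) (h0 x), ENNReal.ofReal_mul (by positivity),
      ENNReal.ofReal_rpow_of_nonneg (h0 x) (by linarith), mul_left_comm,
      ← ENNReal.ofReal_mul (h0 x)]
    congr 2
    rcases (h0 x).eq_or_lt with h | h
    · rw [← h]; simp; rw [Real.zero_rpow (by linarith)]
    · nth_rewrite 1 [← Real.rpow_one (f x)]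
      rw [← Real.rpow_add h]; congr 1; ring
  rw [e3, e1]
  have e5 : ∫⁻ t in Ioi (0:ℝ), volume {a | t < g a} * ENNReal.ofReal (t ^ (p - 1)) ≤
      ENNReal.ofReal (2 * 5 ^ n) *
        ∫⁻ t in Ioi (0:ℝ), ν {a | t < 2 * f a} * ENNReal.ofReal (t ^ (p - 1 - 1)) := by
    rw [← lintegral_const_mul' _ _ ofReal_ne_top]
    refine setLIntegral_mono' measurableSet_Ioi fun t ht => ?_
    have ht : 0 < t := ht
    have : t ^ (p - 1) = t * t ^ (p - 1 - 1) := by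
      nth_rewrite 2 [← Real.rpow_one t]
      rw [← Real.rpow_add ht]; congr 1; ring
    rw [this, ENNReal.ofReal_mul ht.le, ← mul_assoc, ← mul_assoc]
    gcongr ?_ * _
    rw [mul_comm]; exact key t ht
  rw [e4] at e2
  have e6 : ∫⁻ t in Ioi (0:ℝ), ν {a | t < 2 * f a} * ENNReal.ofReal (t ^ (p - 1 - 1)) =
      ENNReal.ofReal ((p - 1)⁻¹ * 2 ^ (p - 1)) * ∫⁻ x, ENNReal.ofReal (f x) ^ p := by
    rw [ENNReal.ofReal_mul (by positivity), mul_assoc, e2, ← mul_assoc,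
      ← ENNReal.ofReal_mul (by positivity), inv_mul_cancel₀ hp1.ne', ofReal_one, one_mul]
  calc _ ≤ ENNReal.ofReal p * (ENNReal.ofReal (2 * 5 ^ n) * _) := by gcongr
    _ = _ := by
      rw [e6, ENNReal.ofReal_mul (p := p * (2 * 5 ^ n)) (by positivity),
        ENNReal.ofReal_mul (p := p) (by linarith)]
      ring



lemma HLM_ball_le {n : ℕ} (F : En n → ℝ≥0∞) (x : En n) {r : ℝ} (hr : 0 < r) :
    ∫⁻ y in ball x r, F y ≤ volume (ball x r) * HLM F x := by
  have h : (volume (ball x r))⁻¹ * ∫⁻ y in ball x r, F y ≤ HLM F x :=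
    le_iSup₂ (f := fun (r : ℝ) (_ : 0 < r) => (volume (ball x r))⁻¹ * ∫⁻ y in ball x r, F y) r hr
  calc _ = volume (ball x r) * ((volume (ball x r))⁻¹ * ∫⁻ y in ball x r, F y) := by
        rw [← mul_assoc, ENNReal.mul_inv_cancel (vol_ball_ne_zero x hr) (vol_ball_ne_top x r),
          one_mul]
    _ ≤ _ := by gcongr

lemma vol_ball_eq {n : ℕ} (x : En n) {r : ℝ} (hr : 0 < r) :
    volume (ball x r) = ENNReal.ofReal (r ^ n * (volume (ball (0 : En n) 1)).toReal) := by
  have := vol_ball_mul x hr 1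
  rw [mul_one] at this
  rw [this, Measure.addHaar_ball_center, ENNReal.ofReal_mul (by positivity),
    ofReal_toReal (vol_ball_ne_top _ _)]

lemma holder_ball {n : ℕ} {p : ℝ} (hp : 1 < p) {F : En n → ℝ≥0∞} (hF : Measurable F)
    (x : En n) (r : ℝ) :
    ∫⁻ y in ball x r, F y ≤
      (∫⁻ y, F y ^ p) ^ (1 / p) * volume (ball x r) ^ (1 - 1 / p) := by
  have hpq := Real.HolderConjugate.conjExponent hp
  have h := ENNReal.lintegral_mul_le_Lp_mul_Lq (volume.restrict (ball x r)) hpq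
    hF.aemeasurable (g := fun _ => 1) aemeasurable_const
  simp only [Pi.mul_apply, mul_one, ENNReal.one_rpow, lintegral_const, Measure.restrict_apply_univ,
    one_mul] at h
  have e : 1 / p.conjExponent = 1 - 1 / p := by
    have := hpq.inv_add_inv_eq_one
    simp only [one_div]; linarith
  rw [e] at h
  refine h.trans ?_
  gcongr
  exact Measure.restrict_le_self

lemma annulus_le {n : ℕ} {γ : ℝ} (hγn : γ < n) (f : En n → ℝ) (h0 : ∀ x, 0 ≤ f x) (x : En n)
    {ρ : ℝ} (hρ : 0 < ρ) :
    ∫⁻ y in {y | ρ ≤ ‖x - y‖ ∧ ‖x - y‖ < 2 * ρ}, ENNReal.ofReal (‖x - y‖ ^ (γ - n) * f y) ≤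
      ENNReal.ofReal (ρ ^ (γ - n)) * ∫⁻ y in ball x (2 * ρ), ENNReal.ofReal (f y) := by
  have hm : MeasurableSet {y : En n | ρ ≤ ‖x - y‖ ∧ ‖x - y‖ < 2 * ρ} := by
    have h1 : Measurable fun y : En n => ‖x - y‖ := by fun_prop
    exact (measurableSet_le measurable_const h1).inter (measurableSet_lt h1 measurable_const)
  rw [← lintegral_const_mul' _ _ ofReal_ne_top]
  calc _ ≤ ∫⁻ y in {y | ρ ≤ ‖x - y‖ ∧ ‖x - y‖ < 2 * ρ},
        ENNReal.ofReal (ρ ^ (γ - n)) * ENNReal.ofReal (f y) := by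
        refine setLIntegral_mono' hm fun y hy => ?_
        rw [← ENNReal.ofReal_mul (by positivity)]
        refine ENNReal.ofReal_le_ofReal (mul_le_mul_of_nonneg_right ?_ (h0 y))
        exact Real.rpow_le_rpow_of_nonpos hρ hy.1 (by linarith)
    _ ≤ _ := by
        refine lintegral_mono_set fun y hy => ?_
        rw [mem_ball, dist_comm, dist_eq_norm]; exact hy.2

/-- dyadic decomposition -/
lemma riesz_pointwise {n : ℕ} {γ p : ℝ} (hγ0 : 0 < γ) (hγn : γ < n) (hp : 1 < p)
    (hpn : γ * p < n) :
    ∃ C1 C2 : ℝ, 0 ≤ C1 ∧ 0 ≤ C2 ∧ ∀ f : En n → ℝ, Measurable f → (∀ x, 0 ≤ f x) →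
      ∀ (x : En n) (R : ℝ), 0 < R →
      ∫⁻ y, ENNReal.ofReal (‖x - y‖ ^ (γ - n) * f y) ≤
        ENNReal.ofReal (C1 * R ^ γ) * HLM (fun y => ENNReal.ofReal (f y)) x +
        ENNReal.ofReal (C2 * R ^ (γ - n / p)) * (∫⁻ y, ENNReal.ofReal (f y) ^ p) ^ (1 / p) := by
  set V := (volume (ball (0 : En n) 1)).toReal
  have hV : 0 ≤ V := toReal_nonneg
  have hp0 : 0 < p := by linarith
  have hκ : γ - n / p < 0 := by
    rw [sub_neg, lt_div_iff₀ hp0]; exact hpn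
  have hpinv : 0 ≤ 1 - 1 / p := by
    rw [sub_nonneg, div_le_one hp0]; exact hp.le
  -- geometric ratios
  set a : ℝ := 2 ^ (-γ) with ha
  set b : ℝ := 2 ^ (γ - n / p) with hb
  have ha0 : 0 < a := by positivity
  have hb0 : 0 < b := by positivity
  have ha1 : a < 1 := Real.rpow_lt_one_of_one_lt_of_neg (by norm_num) (by linarith)
  have hb1 : b < 1 := Real.rpow_lt_one_of_one_lt_of_neg (by norm_num) hκ
  refine ⟨2 ^ n * V * a * (1 - a)⁻¹, (2 ^ n * V) ^ (1 - 1 / p) * (1 - b)⁻¹, ?_, ?_, ?_⟩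
  · have := sub_pos.2 ha1; positivity
  · have := sub_pos.2 hb1; positivity
  intro f hf h0 x R hR
  set F : En n → ℝ≥0∞ := fun y => ENNReal.ofReal (f y)
  have hF : Measurable F := hf.ennreal_ofReal
  set h : En n → ℝ≥0∞ := fun y => ENNReal.ofReal (‖x - y‖ ^ (γ - n) * f y)
  set Ann : ℝ → Set (En n) := fun ρ => {y | ρ ≤ ‖x - y‖ ∧ ‖x - y‖ < 2 * ρ} with hAnn
  set M := HLM F x
  set N := (∫⁻ y, F y ^ p) ^ (1 / p)
  have bound1 : ∀ ρ, 0 < ρ → ∫⁻ y in Ann ρ, h y ≤ ENNReal.ofReal (2 ^ n * V * ρ ^ γ) * M := by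
    intro ρ hρ
    refine (annulus_le hγn f h0 x hρ).trans ?_
    calc _ ≤ ENNReal.ofReal (ρ ^ (γ - n)) * (volume (ball x (2 * ρ)) * M) := by
          gcongr; exact HLM_ball_le F x (by positivity)
      _ = _ := by
          rw [vol_ball_eq x (by positivity), ← mul_assoc, ← ENNReal.ofReal_mul (by positivity)]
          congr 2
          rw [Real.rpow_sub hρ, Real.rpow_natCast, mul_pow]
          field_simp
          rfl
  have bound2 : ∀ ρ, 0 < ρ → ∫⁻ y in Ann ρ, h y ≤
      ENNReal.ofReal ((2 ^ n * V) ^ (1 - 1 / p) * ρ ^ (γ - n / p)) * N := by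
    intro ρ hρ
    refine (annulus_le hγn f h0 x hρ).trans ?_
    calc _ ≤ ENNReal.ofReal (ρ ^ (γ - n)) * (N * volume (ball x (2 * ρ)) ^ (1 - 1 / p)) := by
          gcongr; exact holder_ball hp hF x _
      _ = ENNReal.ofReal (ρ ^ (γ - n)) * volume (ball x (2 * ρ)) ^ (1 - 1 / p) * N := by ring
      _ = _ := by
          rw [vol_ball_eq x (by positivity), ENNReal.ofReal_rpow_of_nonneg (by positivity) hpinv,
            ← ENNReal.ofReal_mul (by positivity)]
          congr 2
          change _ * ((2 * ρ) ^ n * V) ^ (1 - 1 / p) = _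
          rw [show (2 * ρ) ^ n * V = (2 ^ n * V) * ρ ^ (n : ℝ) by
            rw [Real.rpow_natCast, mul_pow]; ring,
            Real.mul_rpow (by positivity) (by positivity), ← Real.rpow_mul hρ.le, mul_left_comm,
            ← Real.rpow_add hρ]
          congr 2
          field_simp; ring
  -- covering
  have hcov : (univ : Set (En n)) ⊆ {x} ∪
      ((⋃ k : ℕ, Ann (R * 2⁻¹ ^ (k + 1))) ∪ ⋃ k : ℕ, Ann (R * 2 ^ k)) := by
    intro y _
    by_cases hy : y = x
    · exact Or.inl hy
    right
    have hpos : 0 < ‖x - y‖ / R := div_pos (norm_pos_iff.2 (sub_ne_zero.2 (Ne.symm hy))) hR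
    obtain ⟨k, hk1, hk2⟩ := exists_mem_Ico_zpow hpos (by norm_num : (1:ℝ) < 2)
    rw [le_div_iff₀ hR] at hk1
    rw [div_lt_iff₀ hR, zpow_add_one₀ (by norm_num)] at hk2
    rcases k with k | k
    · right
      refine mem_iUnion.2 ⟨k, ?_, ?_⟩
      · simp only [Int.ofNat_eq_natCast, zpow_natCast] at hk1; linarith
      · simp only [Int.ofNat_eq_natCast, zpow_natCast] at hk2; linarith
    · left
      refine mem_iUnion.2 ⟨k, ?_, ?_⟩
      · rw [zpow_negSucc, ← inv_pow] at hk1; linarith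
      · rw [zpow_negSucc, ← inv_pow] at hk2; linarith
  have hx0 : h x = 0 := by
    simp only [h, sub_self, norm_zero]
    rw [Real.zero_rpow (by linarith)]; simp
  have hnear : ∫⁻ y in ⋃ k : ℕ, Ann (R * 2⁻¹ ^ (k + 1)), h y ≤
      ENNReal.ofReal (2 ^ n * V * a * (1 - a)⁻¹ * R ^ γ) * M := by
    calc _ ≤ ∑' k : ℕ, ∫⁻ y in Ann (R * 2⁻¹ ^ (k + 1)), h y := lintegral_iUnion_le _ _
      _ ≤ ∑' k : ℕ, ENNReal.ofReal (2 ^ n * V * (R * 2⁻¹ ^ (k + 1)) ^ γ) * M := by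
          gcongr with k; exact bound1 _ (by positivity)
      _ = ∑' k : ℕ, ENNReal.ofReal (2 ^ n * V * a * R ^ γ * a ^ k) * M := by
          refine tsum_congr fun k => ?_
          congr 2
          have : ((2:ℝ)⁻¹ ^ (k + 1)) ^ γ = a ^ (k + 1) := by
            rw [← Real.rpow_natCast, ← Real.rpow_mul (by norm_num),
              mul_comm _ γ, Real.rpow_mul (by norm_num), Real.inv_rpow (by norm_num),
              ← Real.rpow_neg (by norm_num), ← ha, Real.rpow_natCast]
          rw [Real.mul_rpow hR.le (by positivity), this, pow_succ]
          ring
      _ = _ := by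
          rw [ENNReal.tsum_mul_right, ← ENNReal.ofReal_tsum_of_nonneg (fun k => by positivity)
            ((summable_geometric_of_lt_one ha0.le ha1).mul_left _), tsum_mul_left,
            tsum_geometric_of_lt_one ha0.le ha1]
          congr 2; ring
  have hfar : ∫⁻ y in ⋃ k : ℕ, Ann (R * 2 ^ k), h y ≤
      ENNReal.ofReal ((2 ^ n * V) ^ (1 - 1 / p) * (1 - b)⁻¹ * R ^ (γ - n / p)) * N := by
    calc _ ≤ ∑' k : ℕ, ∫⁻ y in Ann (R * 2 ^ k), h y := lintegral_iUnion_le _ _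
      _ ≤ ∑' k : ℕ, ENNReal.ofReal ((2 ^ n * V) ^ (1 - 1 / p) * (R * 2 ^ k) ^ (γ - n / p)) * N := by
          gcongr with k; exact bound2 _ (by positivity)
      _ = ∑' k : ℕ, ENNReal.ofReal ((2 ^ n * V) ^ (1 - 1 / p) * R ^ (γ - n / p) * b ^ k) * N := by
          refine tsum_congr fun k => ?_
          congr 2
          have : ((2:ℝ) ^ k) ^ (γ - n / p) = b ^ k := by
            rw [← Real.rpow_natCast, ← Real.rpow_mul (by norm_num),
              mul_comm _ (γ - n / p), Real.rpow_mul (by norm_num), ← hb, Real.rpow_natCast]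
          rw [Real.mul_rpow hR.le (by positivity), this]
          ring
      _ = _ := by
          rw [ENNReal.tsum_mul_right, ← ENNReal.ofReal_tsum_of_nonneg (fun k => by positivity)
            ((summable_geometric_of_lt_one hb0.le hb1).mul_left _), tsum_mul_left,
            tsum_geometric_of_lt_one hb0.le hb1]
          congr 2; ring
  calc ∫⁻ y, h y = ∫⁻ y in univ, h y := by rw [setLIntegral_univ]
    _ ≤ ∫⁻ y in {x} ∪ ((⋃ k : ℕ, Ann (R * 2⁻¹ ^ (k + 1))) ∪ ⋃ k : ℕ, Ann (R * 2 ^ k)), h y :=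
        lintegral_mono_set hcov
    _ ≤ (∫⁻ y in {x}, h y) + ((∫⁻ y in ⋃ k : ℕ, Ann (R * 2⁻¹ ^ (k + 1)), h y) +
        ∫⁻ y in ⋃ k : ℕ, Ann (R * 2 ^ k), h y) := by
        refine (lintegral_union_le _ _ _).trans ?_
        gcongr
        exact lintegral_union_le _ _ _
    _ ≤ _ := by
        rw [lintegral_singleton, hx0, zero_mul, zero_add]
        exact add_le_add hnear hfar

/-- Hardy-Littlewood-Sobolev inequality. -/
lemma HLS {n : ℕ} (hn : 0 < n) {γ p q : ℝ} (hγ0 : 0 < γ) (hγn : γ < n) (hp : 1 < p)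
    (hpn : γ * p < n) (hq : 1 / q = 1 / p - γ / n) :
    ∃ C : ℝ, 0 ≤ C ∧ ∀ (f : En n → ℝ) (B : ℝ), Measurable f → (∀ x, 0 ≤ f x) → (∀ x, f x ≤ B) →
      Integrable f volume → ∫⁻ x, ENNReal.ofReal (f x) ^ p ≠ ⊤ →
      ∫⁻ x, (∫⁻ y, ENNReal.ofReal (‖x - y‖ ^ (γ - n) * f y)) ^ q ≤
        ENNReal.ofReal C * (∫⁻ x, ENNReal.ofReal (f x) ^ p) ^ (q / p) := by
  obtain ⟨C1, C2, hC1, hC2, hpt⟩ := riesz_pointwise hγ0 hγn hp hpn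
  obtain ⟨C3, hC3, hM⟩ := HLM_strong hn hp
  have hp0 : 0 < p := by linarith
  have hn0 : (0:ℝ) < n := by exact_mod_cast hn
  have hqi : 0 < 1 / q := by
    rw [hq, sub_pos, div_lt_div_iff₀ hn0 hp0]; linarith
  have hq0 : 0 < q := by simpa using hqi
  have hpq : p / q = 1 - γ * p / n := by
    rw [div_eq_mul_one_div, hq]; field_simp
  refine ⟨(C1 + C2) ^ q * C3, by positivity, fun f B hf h0 hB hIntg hfin => ?_⟩
  set F : En n → ℝ≥0∞ := fun y => ENNReal.ofReal (f y) with hFdef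
  have hF : Measurable F := hf.ennreal_ofReal
  set J := ∫⁻ x, F x ^ p with hJ
  by_cases hJ0 : J = 0
  · have hae : ∀ᵐ y, F y = 0 := by
      have := (lintegral_eq_zero_iff (hF.pow_const p)).1 hJ0
      filter_upwards [this] with y hy
      have hy : F y ^ p = 0 := hy
      rcases ENNReal.rpow_eq_zero_iff.1 hy with h | h
      · exact h.1
      · linarith [h.2]
    have : ∀ x, ∫⁻ y, ENNReal.ofReal (‖x - y‖ ^ (γ - n) * f y) = 0 := by
      intro x
      rw [← lintegral_zero (μ := (volume : Measure (En n)))]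
      refine lintegral_congr_ae ?_
      filter_upwards [hae] with y hy
      rw [ENNReal.ofReal_mul (by positivity)]
      change _ * F y = 0
      rw [hy, mul_zero]
    simp [this, hq0]
  have hMtop : ∀ x, HLM F x ≠ ⊤ := fun x => ne_top_of_le_ne_top ofReal_ne_top
    (HLM_le_const (fun x => ENNReal.ofReal_le_ofReal (hB x)) x)
  have hMpos : ∀ x, HLM F x ≠ 0 := by
    intro x hx
    have hball : ∀ k : ℕ, ∫⁻ y in ball x (k + 1), F y = 0 := by
      intro k
      have := HLM_ball_le F x (r := (k:ℝ) + 1) (by positivity)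
      rw [hx, mul_zero] at this
      exact le_antisymm this bot_le
    have hU : (⋃ k : ℕ, ball x ((k : ℝ) + 1)) = univ := by
      rw [eq_univ_iff_forall]
      intro y
      obtain ⟨k, hk⟩ := exists_nat_gt (dist y x)
      exact mem_iUnion.2 ⟨k, by rw [mem_ball]; linarith⟩
    have hzero : ∫⁻ y, F y = 0 := by
      rw [← setLIntegral_univ, ← hU]
      refine le_antisymm ((lintegral_iUnion_le _ _).trans ?_) bot_le
      simp [hball]
    apply hJ0
    rw [hJ, lintegral_eq_zero_iff (hF.pow_const p)]
    filter_upwards [(lintegral_eq_zero_iff hF).1 hzero] with y hy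
    have hy : F y = 0 := hy
    simp [hy, hp0]
  set N := J ^ (1 / p) with hN
  have hNtop : N ≠ ⊤ := ENNReal.rpow_ne_top_of_nonneg (by positivity) hfin
  have hN0 : N ≠ 0 := by
    rw [hN, Ne, ENNReal.rpow_eq_zero_iff]; push Not
    exact ⟨fun h => absurd h hJ0, fun h => absurd h hfin⟩
  have hpt2 : ∀ x, ∫⁻ y, ENNReal.ofReal (‖x - y‖ ^ (γ - n) * f y) ≤
      ENNReal.ofReal (C1 + C2) * (N ^ (1 - p / q) * HLM F x ^ (p / q)) := by
    intro x
    set a := (HLM F x).toReal with ha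
    set b := N.toReal with hb
    have ha0 : 0 < a := ENNReal.toReal_pos (hMpos x) (hMtop x)
    have hb0 : 0 < b := ENNReal.toReal_pos hN0 hNtop
    have hea : HLM F x = ENNReal.ofReal a := (ofReal_toReal (hMtop x)).symm
    have heb : N = ENNReal.ofReal b := (ofReal_toReal hNtop).symm
    set R := (b / a) ^ (p / n) with hR
    have hR0 : 0 < R := by positivity
    refine (hpt f hf h0 x R hR0).trans ?_
    change _ * HLM F x + _ * N ≤ _
    rw [hea, heb, ENNReal.ofReal_rpow_of_pos ha0, ENNReal.ofReal_rpow_of_pos hb0,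
      ← ENNReal.ofReal_mul (by positivity), ← ENNReal.ofReal_mul (by positivity),
      ← ENNReal.ofReal_mul (by positivity), ← ENNReal.ofReal_mul (by positivity),
      ← ENNReal.ofReal_add (by positivity) (by positivity)]
    refine ENNReal.ofReal_le_ofReal (le_of_eq ?_)
    have k1 : R ^ γ * a = b ^ (1 - p / q) * a ^ (p / q) := by
      rw [hR, ← Real.rpow_mul (by positivity), Real.div_rpow hb0.le ha0.le, hpq,
        show p / n * γ = γ * p / n by ring, sub_sub_self, Real.rpow_sub ha0, Real.rpow_one]
      ring
    have k2 : R ^ (γ - n / p) * b = R ^ γ * a := by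
      have : R ^ ((n : ℝ) / p) = b / a := by
        rw [hR, ← Real.rpow_mul (by positivity), show p / n * (n / p) = (1:ℝ) by field_simp,
          Real.rpow_one]
      rw [Real.rpow_sub hR0, this]
      field_simp
    rw [mul_assoc, mul_assoc, k2, k1]; ring
  calc _ ≤ ∫⁻ x, (ENNReal.ofReal (C1 + C2) * (N ^ (1 - p / q) * HLM F x ^ (p / q))) ^ q := by
        gcongr with x; exact hpt2 x
    _ = ∫⁻ x, (ENNReal.ofReal ((C1 + C2) ^ q) * N ^ (q - p)) * HLM F x ^ p := by
        refine lintegral_congr fun x => ?_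
        rw [ENNReal.mul_rpow_of_nonneg _ _ hq0.le, ENNReal.mul_rpow_of_nonneg _ _ hq0.le,
          ENNReal.ofReal_rpow_of_nonneg (by positivity) hq0.le, ← ENNReal.rpow_mul N,
          ← ENNReal.rpow_mul (HLM F x), mul_assoc]
        have k1 : (1 - p / q) * q = q - p := by field_simp
        have k2 : p / q * q = p := by field_simp
        rw [k1, k2]
    _ = (ENNReal.ofReal ((C1 + C2) ^ q) * N ^ (q - p)) * ∫⁻ x, HLM F x ^ p := by
        rw [lintegral_const_mul _ ((HLM_measurable hF).pow_const p)]
    _ ≤ (ENNReal.ofReal ((C1 + C2) ^ q) * N ^ (q - p)) * (ENNReal.ofReal C3 * J) := by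
        gcongr; exact hM f B hf h0 hB hIntg
    _ = _ := by
        have : J ^ (q / p) = N ^ (q - p) * J := by
          nth_rewrite 2 [← ENNReal.rpow_one J]
          rw [hN, ← ENNReal.rpow_mul, ← ENNReal.rpow_add _ _ hJ0 hfin]
          congr 1; field_simp; ring
        rw [this, ENNReal.ofReal_mul (by positivity)]; ring

end Maximal

section Taylor
open scoped ContDiff Convolution

/-- Iterated partial derivative along a list of directions. -/
def listPDeriv {n : ℕ} (l : List (Fin n)) (α : Fin n → ℕ) (f : En n → ℝ) : En n → ℝ :=
  (l.foldr (fun i g => (pderivFun i)^[α i] ∘ g) id) f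

lemma listPDeriv_cons {n : ℕ} (i : Fin n) (l : List (Fin n)) (α : Fin n → ℕ) (f : En n → ℝ) :
    listPDeriv (i :: l) α f = (pderivFun i)^[α i] (listPDeriv l α f) := rfl

lemma listPDeriv_rel {n : ℕ} (R : ℕ → (En n → ℝ) → (En n → ℝ) → Prop)
    (hR : ∀ k i f g, R k f g → R (k + 1) (pderivFun i f) (pderivFun i g))
    (l : List (Fin n)) (α : Fin n → ℕ) (f g : En n → ℝ) (h : R 0 f g) :
    R (l.map α).sum (listPDeriv l α f) (listPDeriv l α g) := by
  induction l with
  | nil => exact h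
  | cons i l ih =>
    rw [listPDeriv_cons, listPDeriv_cons, List.map_cons, List.sum_cons]
    have : ∀ j k f g, R k f g → R (j + k) ((pderivFun i)^[j] f) ((pderivFun i)^[j] g) := by
      intro j
      induction j with
      | zero => intro k f g h; simpa using h
      | succ j ihj =>
        intro k f g h
        rw [Function.iterate_succ_apply', Function.iterate_succ_apply', Nat.add_right_comm]
        exact hR _ _ _ _ (ihj k f g h)
    exact this _ _ _ _ ih

lemma iterPDeriv_rel {n : ℕ} (R : ℕ → (En n → ℝ) → (En n → ℝ) → Prop)
    (hR : ∀ k i f g, R k f g → R (k + 1) (pderivFun i f) (pderivFun i g))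
    (α : Fin n → ℕ) (f g : En n → ℝ) (h : R 0 f g) :
    R (∑ i, α i) (iterPDeriv α f) (iterPDeriv α g) := by
  have := listPDeriv_rel R hR (List.finRange n) α f g h
  have e : ((List.finRange n).map α).sum = ∑ i, α i := by
    rw [← List.ofFn_eq_map, List.sum_ofFn]
  rwa [e] at this

lemma contDiff_pderivFun {n : ℕ} (i : Fin n) {f : En n → ℝ} (hf : ContDiff ℝ ∞ f) :
    ContDiff ℝ ∞ (pderivFun i f) := by
  have : ContDiff ℝ ∞ (fderiv ℝ f) := hf.fderiv_right (by simp)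
  exact this.clm_apply contDiff_const

lemma contDiff_listPDeriv {n : ℕ} (l : List (Fin n)) (α : Fin n → ℕ) {f : En n → ℝ}
    (hf : ContDiff ℝ ∞ f) : ContDiff ℝ ∞ (listPDeriv l α f) :=
  listPDeriv_rel (fun _ f _ => ContDiff ℝ ∞ f) (fun _ i _ _ h => contDiff_pderivFun i h) l α f f hf

lemma contDiff_iterPDeriv {n : ℕ} (α : Fin n → ℕ) {f : En n → ℝ}
    (hf : ContDiff ℝ ∞ f) : ContDiff ℝ ∞ (iterPDeriv α f) :=
  contDiff_listPDeriv _ α hf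

lemma pderivFun_comm {n : ℕ} (i j : Fin n) {f : En n → ℝ} (hf : ContDiff ℝ ∞ f) :
    pderivFun i (pderivFun j f) = pderivFun j (pderivFun i f) := by
  have hd : Differentiable ℝ (fderiv ℝ f) :=
    (hf.fderiv_right (m := ∞) (by simp)).differentiable (by simp)
  have key : ∀ (i j : Fin n) (x : En n), pderivFun i (pderivFun j f) x =
      fderiv ℝ (fderiv ℝ f) x (EuclideanSpace.single i 1) (EuclideanSpace.single j 1) := by
    intro i j x
    unfold pderivFun
    rw [fderiv_clm_apply (hd x) (differentiableAt_const _)]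
    simp
  funext x
  rw [key, key]
  have hs : IsSymmSndFDerivAt ℝ f x := hf.contDiffAt.isSymmSndFDerivAt (by
    simp only [minSmoothness_of_isRCLikeNormedField]; exact ENat.LEInfty.out)
  exact hs _ _

lemma pderivFun_iterate_comm {n : ℕ} (i j : Fin n) (k : ℕ) {f : En n → ℝ} (hf : ContDiff ℝ ∞ f) :
    pderivFun i ((pderivFun j)^[k] f) = (pderivFun j)^[k] (pderivFun i f) := by
  induction k generalizing f with
  | zero => rfl
  | succ k ih =>
    rw [Function.iterate_succ_apply, Function.iterate_succ_apply, ih (contDiff_pderivFun j hf),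
      pderivFun_comm i j hf]

lemma listPDeriv_congr {n : ℕ} (l : List (Fin n)) (α α' : Fin n → ℕ) (f : En n → ℝ)
    (h : ∀ i ∈ l, α i = α' i) : listPDeriv l α f = listPDeriv l α' f := by
  induction l with
  | nil => rfl
  | cons i l ih =>
    rw [listPDeriv_cons, listPDeriv_cons, ih (fun j hj => h j (List.mem_cons_of_mem _ hj)),
      h i List.mem_cons_self]

lemma pderivFun_listPDeriv {n : ℕ} (l : List (Fin n)) (hl : l.Nodup) (i : Fin n) (hi : i ∈ l)
    (α : Fin n → ℕ) {f : En n → ℝ} (hf : ContDiff ℝ ∞ f) :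
    pderivFun i (listPDeriv l α f) = listPDeriv l (α + Pi.single i 1) f := by
  induction l with
  | nil => simp at hi
  | cons j l ih =>
    rw [listPDeriv_cons, listPDeriv_cons]
    rw [List.nodup_cons] at hl
    by_cases hij : i = j
    · subst hij
      rw [← listPDeriv_congr l α (α + Pi.single i 1) f]
      · have : (α + Pi.single i 1 : Fin n → ℕ) i = α i + 1 := by simp
        rw [this, Function.iterate_succ_apply']
      · intro k hk
        have : k ≠ i := fun h => hl.1 (h ▸ hk)
        simp [this]
    · have hil : i ∈ l := by
        rcases List.mem_cons.1 hi with h | h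
        · exact absurd h hij
        · exact h
      rw [pderivFun_iterate_comm i j _ (contDiff_listPDeriv l α hf), ih hl.2 hil]
      have : j ≠ i := fun h => hij h.symm
      simp [this]

lemma pderivFun_iterPDeriv {n : ℕ} (i : Fin n) (α : Fin n → ℕ) {f : En n → ℝ}
    (hf : ContDiff ℝ ∞ f) :
    pderivFun i (iterPDeriv α f) = iterPDeriv (α + Pi.single i 1) f :=
  pderivFun_listPDeriv _ (List.nodup_finRange n) i (List.mem_finRange i) α hf

lemma fderiv_eq_sum {n : ℕ} (f : En n → ℝ) (x h : En n) :
    fderiv ℝ f x h = ∑ i, h i * pderivFun i f x := by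
  have : h = ∑ i, h i • EuclideanSpace.single i (1 : ℝ) := by
    have := (EuclideanSpace.basisFun (Fin n) ℝ).sum_repr h
    simpa using this.symm
  conv_lhs => rw [this, map_sum]
  simp [pderivFun]

/-- Reindexing of multi-indices. -/
lemma multiindex_sum {n : ℕ} (k : ℕ) (c : (Fin n → ℕ) → ℝ) (h : Fin n → ℝ) :
    ∑ α ∈ Finset.Nat.antidiagonalTuple n k, ∑ i,
      ((∏ j, Nat.factorial (α j) : ℕ) : ℝ)⁻¹ * (h i * c (α + Pi.single i 1)) * ∏ j, h j ^ α j =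
    (k + 1) * ∑ γ ∈ Finset.Nat.antidiagonalTuple n (k + 1),
      ((∏ j, Nat.factorial (γ j) : ℕ) : ℝ)⁻¹ * c γ * ∏ j, h j ^ γ j := by
  have step : ∀ γ ∈ Finset.Nat.antidiagonalTuple n (k + 1),
      ((k : ℝ) + 1) * (((∏ j, Nat.factorial (γ j) : ℕ) : ℝ)⁻¹ * c γ * ∏ j, h j ^ γ j) =
      ∑ i, (γ i : ℝ) * (((∏ j, Nat.factorial (γ j) : ℕ) : ℝ)⁻¹ * c γ * ∏ j, h j ^ γ j) := by
    intro γ hγ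
    rw [← Finset.sum_mul]
    congr 1
    have := Finset.Nat.mem_antidiagonalTuple.1 hγ
    exact_mod_cast this.symm
  rw [Finset.mul_sum, Finset.sum_congr rfl step, Finset.sum_comm]
  conv_rhs => rw [Finset.sum_comm]
  refine Finset.sum_congr rfl fun i _ => ?_
  symm
  rw [← Finset.sum_filter_of_ne (p := fun γ : Fin n → ℕ => γ i ≠ 0)]
  swap
  · intro γ _ hne h0
    apply hne; simp [h0]
  refine Finset.sum_bij' (fun γ _ => γ - Pi.single i 1) (fun α _ => α + Pi.single i 1) ?_ ?_ ?_ ?_ ?_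
  · intro γ hγ
    rw [Finset.mem_filter, Finset.Nat.mem_antidiagonalTuple] at hγ
    rw [Finset.Nat.mem_antidiagonalTuple]
    have h1 : γ = (γ - Pi.single i 1) + Pi.single i 1 := by
      funext j
      by_cases hj : j = i
      · subst hj; have := hγ.2; simp; omega
      · simp [hj]
    have h2 := hγ.1
    rw [h1] at h2
    simp only [Pi.add_apply, Finset.sum_add_distrib] at h2
    have h3 : ∑ x, (Pi.single i 1 : Fin n → ℕ) x = 1 := by simp
    omega
  · intro α hα
    rw [Finset.mem_filter, Finset.Nat.mem_antidiagonalTuple]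
    rw [Finset.Nat.mem_antidiagonalTuple] at hα
    constructor
    · simp only [Pi.add_apply, Finset.sum_add_distrib, hα]
      simp
    · simp
  · intro γ hγ
    rw [Finset.mem_filter] at hγ
    funext j
    by_cases hj : j = i
    · subst hj; have := hγ.2; simp; omega
    · simp [hj]
  · intro α hα
    funext j; simp
  · intro γ hγ
    rw [Finset.mem_filter] at hγ
    obtain ⟨α, rfl⟩ : ∃ α : Fin n → ℕ, γ = α + Pi.single i 1 := by
      refine ⟨γ - Pi.single i 1, ?_⟩
      funext j
      by_cases hj : j = i
      · subst hj; have := hγ.2; simp; omega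
      · simp [hj]
    have e1 : α + Pi.single i 1 - Pi.single i 1 = α := by funext j; simp
    rw [e1]
    have e2 : (∏ j, Nat.factorial ((α + Pi.single i 1 : Fin n → ℕ) j)) =
        (α i + 1) * ∏ j, Nat.factorial (α j) := by
      rw [← Finset.mul_prod_erase _ _ (Finset.mem_univ i),
        ← Finset.mul_prod_erase _ (fun j => Nat.factorial (α j)) (Finset.mem_univ i)]
      have : ∏ j ∈ Finset.univ.erase i, Nat.factorial ((α + Pi.single i 1 : Fin n → ℕ) j) =
          ∏ j ∈ Finset.univ.erase i, Nat.factorial (α j) := by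
        refine Finset.prod_congr rfl fun j hj => ?_
        have := Finset.ne_of_mem_erase hj
        simp [this]
      rw [this]
      simp [Nat.factorial_succ, mul_assoc]
    have e3 : (∏ j, h j ^ ((α + Pi.single i 1 : Fin n → ℕ) j)) = h i * ∏ j, h j ^ α j := by
      rw [← Finset.mul_prod_erase _ _ (Finset.mem_univ i),
        ← Finset.mul_prod_erase _ (fun j => h j ^ (α j)) (Finset.mem_univ i)]
      have : ∏ j ∈ Finset.univ.erase i, h j ^ ((α + Pi.single i 1 : Fin n → ℕ) j) =
          ∏ j ∈ Finset.univ.erase i, h j ^ (α j) := by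
        refine Finset.prod_congr rfl fun j hj => ?_
        have := Finset.ne_of_mem_erase hj
        simp [this]
      rw [this]
      simp [pow_succ]; ring
    rw [e2, e3]
    have hne : ((∏ j, Nat.factorial (α j) : ℕ) : ℝ) ≠ 0 := by
      exact_mod_cast Finset.prod_ne_zero_iff.2 fun j _ => Nat.factorial_ne_zero _
    have hne2 : ((α i : ℝ) + 1) ≠ 0 := by positivity
    simp only [Pi.add_apply, Pi.single_eq_same]
    push_cast at hne ⊢
    field_simp

/-- One-dimensional Taylor estimate. -/
lemma taylor_1d (j : ℕ) : ∀ (H : ℕ → ℝ → ℝ) (B : ℝ),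
    (∀ k t, HasDerivAt (H k) (H (k + 1) t) t) →
    (∀ t ∈ Set.Icc (0:ℝ) 1, |H j t - H j 0| ≤ B) →
    ∀ t ∈ Set.Icc (0:ℝ) 1,
      |H 0 t - ∑ k ∈ Finset.range (j + 1), H k 0 * ((k.factorial : ℝ)⁻¹ * t ^ k)| ≤ B := by
  induction j with
  | zero =>
    intro H B hH hB t ht
    simpa using hB t ht
  | succ j ih =>
    intro H B hH hB t ht
    have h1 := ih (fun k => H (k + 1)) B (fun k t => hH (k + 1) t) hB
    set u : ℝ → ℝ := fun t =>
      H 0 t - ∑ k ∈ Finset.range (j + 1 + 1), H k 0 * ((k.factorial : ℝ)⁻¹ * t ^ k) with hu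
    have hu' : ∀ s, HasDerivAt u
        (H 1 s - ∑ k ∈ Finset.range (j + 1), H (k + 1) 0 * ((k.factorial : ℝ)⁻¹ * s ^ k)) s := by
      intro s
      have h2 : HasDerivAt (fun t : ℝ => ∑ k ∈ Finset.range (j + 1 + 1),
          H k 0 * ((k.factorial : ℝ)⁻¹ * t ^ k))
          (∑ k ∈ Finset.range (j + 1 + 1), H k 0 * ((k.factorial : ℝ)⁻¹ * (k * s ^ (k - 1)))) s := by
        refine HasDerivAt.fun_sum fun k _ => ?_
        exact ((hasDerivAt_pow k s).const_mul _).const_mul _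
      have h3 := (hH 0 s).sub h2
      rw [Finset.sum_range_succ'] at h3
      refine h3.congr_deriv ?_
      congr 1
      simp only [Nat.cast_zero, zero_mul, mul_zero, add_zero]
      refine Finset.sum_congr rfl fun k _ => ?_
      rw [Nat.factorial_succ, Nat.add_sub_cancel]
      push_cast
      have : ((k : ℝ) + 1) ≠ 0 := by positivity
      have : ((k.factorial : ℕ) : ℝ) ≠ 0 := by exact_mod_cast Nat.factorial_ne_zero k
      field_simp
    have hu0 : u 0 = 0 := by
      simp only [hu]
      rw [Finset.sum_range_succ']
      simp
    have hB0 : 0 ≤ B := (abs_nonneg _).trans (hB 0 (by simp))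
    have := (convex_Icc (0:ℝ) 1).norm_image_sub_le_of_norm_hasDerivWithin_le
      (f := u) (C := B) (fun s _ => (hu' s).hasDerivWithinAt) (fun s hs => h1 s hs)
      (Set.left_mem_Icc.2 zero_le_one) ht
    rw [hu0, sub_zero, sub_zero, Real.norm_eq_abs, Real.norm_eq_abs] at this
    refine this.trans ?_
    rw [abs_of_nonneg ht.1]
    exact mul_le_of_le_one_right hB0 ht.2

lemma taylor_smooth {n m : ℕ} {β : ℝ} (hβ : 0 < β) {F : En n → ℝ} (hF : ContDiff ℝ ∞ F)
    (L : (Fin n → ℕ) → ℝ) (hL0 : ∀ α ∈ Finset.Nat.antidiagonalTuple n m, 0 ≤ L α)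
    (hL : ∀ α ∈ Finset.Nat.antidiagonalTuple n m, LipBound β (iterPDeriv α F) (L α)) (x y : En n) :
    |Rm (m + 1) F (fun α => iterPDeriv α F) x y| ≤
      (m.factorial * ∑ α ∈ Finset.Nat.antidiagonalTuple n m, L α) * (‖x - y‖ ^ β * ‖x - y‖ ^ m) := by
  set h : En n := x - y with hh
  set G : ℕ → ℝ → ℝ := fun k t => ∑ α ∈ Finset.Nat.antidiagonalTuple n k,
    ((∏ i, Nat.factorial (α i) : ℕ) : ℝ)⁻¹ * iterPDeriv α F (y + t • h) * ∏ i, h i ^ α i with hG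
  have hGd : ∀ k t, HasDerivAt (G k) ((k + 1) * G (k + 1) t) t := by
    intro k t
    simp only [hG]
    rw [← multiindex_sum k (fun α => iterPDeriv α F (y + t • h)) (fun i => h i)]
    refine HasDerivAt.fun_sum fun α _ => ?_
    rw [← Finset.sum_mul, ← Finset.mul_sum]
    refine HasDerivAt.mul_const ?_ _
    refine HasDerivAt.const_mul _ ?_
    have hd : DifferentiableAt ℝ (iterPDeriv α F) (y + t • h) :=
      (contDiff_iterPDeriv α hF).differentiable (by simp) _
    have hl : HasDerivAt (fun t : ℝ => y + t • h) h t := by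
      simpa using ((hasDerivAt_id t).smul_const h).const_add y
    have := hd.hasFDerivAt.comp_hasDerivAt t hl
    rw [fderiv_eq_sum] at this
    simp_rw [pderivFun_iterPDeriv _ α hF] at this
    exact this
  set S := ∑ α ∈ Finset.Nat.antidiagonalTuple n m, L α
  have hGm : ∀ t ∈ Set.Icc (0:ℝ) 1, |G m t - G m 0| ≤ S * (‖h‖ ^ β * ‖h‖ ^ m) := by
    intro t ht
    simp only [hG]
    rw [← Finset.sum_sub_distrib, Finset.sum_mul]
    refine (Finset.abs_sum_le_sum_abs _ _).trans (Finset.sum_le_sum fun α hα => ?_)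
    rw [← sub_mul, ← mul_sub, abs_mul, abs_mul]
    have h1 : |((∏ i, Nat.factorial (α i) : ℕ) : ℝ)⁻¹| ≤ 1 := by
      rw [abs_of_nonneg (by positivity)]
      refine inv_le_one_of_one_le₀ ?_
      exact_mod_cast Nat.one_le_iff_ne_zero.2
        (Finset.prod_ne_zero_iff.2 fun j _ => Nat.factorial_ne_zero _)
    have h2 : |∏ i, h i ^ α i| ≤ ‖h‖ ^ m := by
      rw [Finset.abs_prod, ← Finset.Nat.mem_antidiagonalTuple.1 hα, ← Finset.prod_pow_eq_pow_sum]
      refine Finset.prod_le_prod (fun _ _ => abs_nonneg _) fun i _ => ?_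
      rw [abs_pow]
      exact pow_le_pow_left₀ (abs_nonneg _) (PiLp.norm_apply_le h i) _
    have h3 : |iterPDeriv α F (y + t • h) - iterPDeriv α F (y + (0:ℝ) • h)| ≤ L α * ‖h‖ ^ β := by
      refine (hL α hα _ _).trans ?_
      refine mul_le_mul_of_nonneg_left (Real.rpow_le_rpow (norm_nonneg _) ?_ hβ.le) (hL0 α hα)
      rw [add_sub_add_left_eq_sub, zero_smul, sub_zero, norm_smul, Real.norm_eq_abs,
        abs_of_nonneg ht.1]
      exact mul_le_of_le_one_left (norm_nonneg _) ht.2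
    have h4 := hL0 α hα
    calc _ ≤ 1 * (L α * ‖h‖ ^ β) * ‖h‖ ^ m := by gcongr
      _ = _ := by ring
  have hT := taylor_1d m (fun k t => k.factorial * G k t) (m.factorial * (S * (‖h‖ ^ β * ‖h‖ ^ m)))
    (by
      intro k t
      have := (hGd k t).const_mul (k.factorial : ℝ)
      rw [Nat.factorial_succ]; push_cast
      exact this.congr_deriv (by ring))
    (by
      intro t ht
      rw [← mul_sub, abs_mul, abs_of_nonneg (by positivity : (0:ℝ) ≤ m.factorial)]
      exact mul_le_mul_of_nonneg_left (hGm t ht) (by positivity)) 1 (by simp)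
  have e : Rm (m + 1) F (fun α => iterPDeriv α F) x y =
      (Nat.factorial 0 : ℝ) * G 0 1 -
      ∑ k ∈ Finset.range (m + 1), (k.factorial * G k 0) * ((k.factorial : ℝ)⁻¹ * 1 ^ k) := by
    unfold Rm
    congr 1
    · have : Finset.Nat.antidiagonalTuple n 0 = {0} := Finset.Nat.antidiagonalTuple_zero_right n
      simp only [hG, this, Finset.sum_singleton]
      have : iterPDeriv 0 F = F := by
        have := iterPDeriv_rel (n := n) (fun k f g => k = 0 → f = F) (fun k i f g _ h => by omega) 0 F F
          (fun _ => rfl)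
        exact this (by simp)
      simp [this, hh]
    · refine Finset.sum_congr rfl fun k _ => ?_
      have : ((k.factorial : ℕ) : ℝ) ≠ 0 := by exact_mod_cast Nat.factorial_ne_zero k
      rw [one_pow, mul_one, mul_right_comm, mul_inv_cancel₀ this, one_mul]
      simp [hG, hh]
  rw [e, mul_assoc]
  exact hT

lemma pderivFun_convolution {n : ℕ} (i : Fin n) {φ A : En n → ℝ} (hφ : ContDiff ℝ ∞ φ)
    (hc : HasCompactSupport φ) (hA : LocallyIntegrable A volume) :
    pderivFun i (φ ⋆[ContinuousLinearMap.lsmul ℝ ℝ, volume] A) =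
      (pderivFun i φ) ⋆[ContinuousLinearMap.lsmul ℝ ℝ, volume] A := by
  funext x
  have h1 : ContDiff ℝ 1 φ := hφ.of_le (by exact_mod_cast le_top)
  have h := hc.hasFDerivAt_convolution_left (ContinuousLinearMap.lsmul ℝ ℝ) h1 hA x
  unfold pderivFun
  rw [h.fderiv]
  have hex : ConvolutionExistsAt (fderiv ℝ φ) A x
      ((ContinuousLinearMap.lsmul ℝ ℝ : ℝ →L[ℝ] ℝ →L[ℝ] ℝ).precompL (En n)) volume :=
    (hc.fderiv ℝ).convolutionExists_left _ (h1.continuous_fderiv (by simp)) hA x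
  simp only [convolution]
  rw [ContinuousLinearMap.integral_apply hex]
  rfl

lemma hasCompactSupport_pderivFun {n : ℕ} (i : Fin n) {φ : En n → ℝ}
    (hc : HasCompactSupport φ) : HasCompactSupport (pderivFun i φ) :=
  hc.fderiv_apply ℝ _

lemma iterPDeriv_convolution {n : ℕ} (α : Fin n → ℕ) {φ A : En n → ℝ} (hφ : ContDiff ℝ ∞ φ)
    (hc : HasCompactSupport φ) (hA : LocallyIntegrable A volume) :
    iterPDeriv α (φ ⋆[ContinuousLinearMap.lsmul ℝ ℝ, volume] A) =
      (iterPDeriv α φ) ⋆[ContinuousLinearMap.lsmul ℝ ℝ, volume] A :=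
  (iterPDeriv_rel (fun _ f g => ContDiff ℝ ∞ f ∧ HasCompactSupport f ∧
      g = f ⋆[ContinuousLinearMap.lsmul ℝ ℝ, volume] A)
    (fun _ i f g h => ⟨contDiff_pderivFun i h.1, hasCompactSupport_pderivFun i h.2.1, by
      rw [h.2.2, pderivFun_convolution i h.1 h.2.1 hA]⟩) α φ _ ⟨hφ, hc, rfl⟩).2.2

lemma iterPDeriv_reflect {n : ℕ} (α : Fin n → ℕ) {φ : En n → ℝ} (hφ : ContDiff ℝ ∞ φ) (x : En n) :
    iterPDeriv α (fun y => φ (x - y)) = fun y => (-1) ^ (∑ i, α i) * iterPDeriv α φ (x - y) := by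
  refine (iterPDeriv_rel (fun k f g => ContDiff ℝ ∞ f ∧ g = fun y => (-1) ^ k * f (x - y))
    (fun k i f g h => ⟨contDiff_pderivFun i h.1, ?_⟩) α φ _ ⟨hφ, by simp⟩).2
  funext y
  rw [h.2]
  have hd : DifferentiableAt ℝ f (x - y) := h.1.differentiable (by simp) _
  have h1 : HasFDerivAt (fun y : En n => x - y) (-ContinuousLinearMap.id ℝ (En n)) y :=
    (hasFDerivAt_id y).const_sub x
  have h2 := (hd.hasFDerivAt.comp y h1).const_mul ((-1 : ℝ) ^ k)
  have h3 : fderiv ℝ (fun y => (-1 : ℝ) ^ k * f (x - y)) y = _ := h2.fderiv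
  unfold pderivFun
  rw [h3]
  simp [pow_succ]

lemma iterPDeriv_mollify {n : ℕ} (α : Fin n → ℕ) {φ A g : En n → ℝ} (hφ : ContDiff ℝ ∞ φ)
    (hc : HasCompactSupport φ) (hA : LocallyIntegrable A volume) (hg : IsWeakDeriv α A g) :
    iterPDeriv α (φ ⋆[ContinuousLinearMap.lsmul ℝ ℝ, volume] A) =
      φ ⋆[ContinuousLinearMap.lsmul ℝ ℝ, volume] g := by
  rw [iterPDeriv_convolution α hφ hc hA]
  funext x
  rw [convolution_eq_swap, convolution_eq_swap]
  have h := hg (fun y => φ (x - y)) (hφ.comp (contDiff_const.sub contDiff_id))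
    (hc.comp_homeomorph (Homeomorph.subLeft x))
  rw [iterPDeriv_reflect α hφ x] at h
  have e : ∀ y, A y * ((-1 : ℝ) ^ (∑ i, α i) * iterPDeriv α φ (x - y)) =
      (-1 : ℝ) ^ (∑ i, α i) * (iterPDeriv α φ (x - y) * A y) := fun y => by ring
  simp_rw [e] at h
  rw [integral_const_mul] at h
  have h' := mul_left_cancel₀ (pow_ne_zero _ (by norm_num : (-1 : ℝ) ≠ 0)) h
  simp only [ContinuousLinearMap.lsmul_apply, smul_eq_mul]
  rw [h']
  exact integral_congr_ae (Filter.Eventually.of_forall fun y => mul_comm _ _)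

lemma LipBound_mollify {n : ℕ} {β L : ℝ} (φ : ContDiffBump (0 : En n)) {g : En n → ℝ}
    (hg : LocallyIntegrable g volume) (hL : LipBound β g L) :
    LipBound β ((φ.normed volume) ⋆[ContinuousLinearMap.lsmul ℝ ℝ, volume] g) L := by
  intro x y
  have hex : ConvolutionExists (φ.normed volume) g (ContinuousLinearMap.lsmul ℝ ℝ) volume :=
    φ.hasCompactSupport_normed.convolutionExists_left _ φ.continuous_normed hg
  have hx := hex x
  have hy := hex y
  simp only [ConvolutionExistsAt, ContinuousLinearMap.lsmul_apply, smul_eq_mul] at hx hy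
  simp only [convolution, ContinuousLinearMap.lsmul_apply, smul_eq_mul]
  rw [← integral_sub hx hy, ← Real.norm_eq_abs]
  have hIntg : Integrable (φ.normed volume) (volume : Measure (En n)) := φ.integrable_normed
  calc _ ≤ ∫ t, φ.normed volume t * (L * ‖x - y‖ ^ β) := by
        refine norm_integral_le_of_norm_le (hIntg.mul_const _) (Filter.Eventually.of_forall fun t => ?_)
        rw [← mul_sub, norm_mul, Real.norm_eq_abs, Real.norm_eq_abs, abs_of_nonneg (φ.nonneg_normed t)]
        refine mul_le_mul_of_nonneg_left ?_ (φ.nonneg_normed t)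
        have := hL (x - t) (y - t)
        rwa [sub_sub_sub_cancel_right] at this
    _ = _ := by rw [integral_mul_const, φ.integral_normed, one_mul]

/-- The pointwise a.e. Taylor estimate. -/
lemma taylor_ae {n m : ℕ} {β : ℝ} (hβ : 0 < β) {A : En n → ℝ} {DA : (Fin n → ℕ) → En n → ℝ}
    (hA : LocallyIntegrable A volume)
    (hDA : ∀ α : Fin n → ℕ, (∑ i, α i) ≤ m →
      IsWeakDeriv α A (DA α) ∧ LocallyIntegrable (DA α) volume) :
    ∃ G : Set (En n), (∀ᵐ x, x ∈ G) ∧ ∀ L : (Fin n → ℕ) → ℝ,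
      (∀ α ∈ Finset.Nat.antidiagonalTuple n m, 0 ≤ L α) →
      (∀ α ∈ Finset.Nat.antidiagonalTuple n m, LipBound β (DA α) (L α)) →
      ∀ x ∈ G, ∀ y ∈ G, |Rm (m + 1) A DA x y| ≤
        (m.factorial * ∑ α ∈ Finset.Nat.antidiagonalTuple n m, L α) *
          (‖x - y‖ ^ β * ‖x - y‖ ^ m) := by
  set φ : ℕ → ContDiffBump (0 : En n) := fun k =>
    ⟨1 / ((k : ℝ) + 1), 2 * (1 / ((k : ℝ) + 1)), by positivity, by
      have : (0:ℝ) < 1 / ((k : ℝ) + 1) := by positivity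
      linarith⟩ with hφ
  have h1 : Filter.Tendsto (fun k => (φ k).rOut) Filter.atTop (nhds 0) := by
    have := (tendsto_one_div_add_atTop_nhds_zero_nat (𝕜 := ℝ)).const_mul 2
    simpa [hφ] using this
  have h2 : ∀ᶠ k in Filter.atTop, (φ k).rOut ≤ 2 * (φ k).rIn :=
    Filter.Eventually.of_forall fun k => le_rfl
  have conv : ∀ g : En n → ℝ, LocallyIntegrable g volume → ∀ᵐ x, Filter.Tendsto
      (fun k => ((φ k).normed volume ⋆[ContinuousLinearMap.lsmul ℝ ℝ, volume] g) x)
      Filter.atTop (nhds (g x)) := fun g hg =>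
    ContDiffBump.ae_convolution_tendsto_right_of_locallyIntegrable h1 h2 hg
  refine ⟨{x | Filter.Tendsto
      (fun k => ((φ k).normed volume ⋆[ContinuousLinearMap.lsmul ℝ ℝ, volume] A) x)
      Filter.atTop (nhds (A x)) ∧ ∀ α : Fin n → ℕ, (∑ i, α i) ≤ m → Filter.Tendsto
      (fun k => ((φ k).normed volume ⋆[ContinuousLinearMap.lsmul ℝ ℝ, volume] (DA α)) x)
      Filter.atTop (nhds (DA α x))}, ?_, ?_⟩
  · have : ∀ᵐ x, ∀ α : Fin n → ℕ, (∑ i, α i) ≤ m → Filter.Tendsto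
      (fun k => ((φ k).normed volume ⋆[ContinuousLinearMap.lsmul ℝ ℝ, volume] (DA α)) x)
      Filter.atTop (nhds (DA α x)) := by
      rw [ae_all_iff]
      intro α
      by_cases hα : (∑ i, α i) ≤ m
      · filter_upwards [conv _ (hDA α hα).2] with x hx _ using hx
      · exact Filter.Eventually.of_forall fun x h => absurd h hα
    filter_upwards [conv A hA, this] with x hx hx'
    exact ⟨hx, hx'⟩
  intro L hL0 hL x hx y hy
  set F : ℕ → En n → ℝ := fun k =>
    (φ k).normed volume ⋆[ContinuousLinearMap.lsmul ℝ ℝ, volume] A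
  have hφs : ∀ k, ContDiff ℝ ∞ ((φ k).normed (volume : Measure (En n))) := fun k =>
    (φ k).contDiff_normed
  have hφc : ∀ k, HasCompactSupport ((φ k).normed (volume : Measure (En n))) := fun k =>
    (φ k).hasCompactSupport_normed
  have hF : ∀ k, ContDiff ℝ ∞ (F k) := fun k =>
    (hφc k).contDiff_convolution_left _ (hφs k) hA
  have hD : ∀ k (α : Fin n → ℕ), (∑ i, α i) ≤ m → iterPDeriv α (F k) =
      (φ k).normed volume ⋆[ContinuousLinearMap.lsmul ℝ ℝ, volume] (DA α) := fun k α hα =>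
    iterPDeriv_mollify α (hφs k) (hφc k) hA (hDA α hα).1
  have hbound : ∀ k, |Rm (m + 1) (F k) (fun α => iterPDeriv α (F k)) x y| ≤
        (m.factorial * ∑ α ∈ Finset.Nat.antidiagonalTuple n m, L α) *
          (‖x - y‖ ^ β * ‖x - y‖ ^ m) := by
    intro k
    refine taylor_smooth hβ (hF k) L hL0 (fun α hα => ?_) x y
    have hα' : (∑ i, α i) ≤ m := (Finset.Nat.mem_antidiagonalTuple.1 hα).le
    rw [hD k α hα']
    exact LipBound_mollify _ (hDA α hα').2 (hL α hα)
  have hlim : Filter.Tendsto (fun k => Rm (m + 1) (F k) (fun α => iterPDeriv α (F k)) x y)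
      Filter.atTop (nhds (Rm (m + 1) A DA x y)) := by
    unfold Rm
    refine hx.1.sub ?_
    refine tendsto_finset_sum _ fun j hj => tendsto_finset_sum _ fun α hα => ?_
    have hα' : (∑ i, α i) ≤ m := by
      rw [Finset.Nat.mem_antidiagonalTuple.1 hα]
      exact Nat.lt_succ_iff.1 (Finset.mem_range.1 hj)
    refine Filter.Tendsto.mul_const _ (Filter.Tendsto.const_mul _ ?_)
    simp_rw [hD _ α hα']
    exact hy.2 α hα'
  exact le_of_tendsto' hlim.abs hbound

end Taylor

lemma LipBound_nonneg {n : ℕ} (hn : 0 < n) {β : ℝ} {b : En n → ℝ} {L : ℝ}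
    (h : LipBound β b L) : 0 ≤ L := by
  have := h (EuclideanSpace.single ⟨0, hn⟩ 1) 0
  simp at this
  exact (abs_nonneg _).trans this

lemma TA_pointwise {n m : ℕ} (hm : 0 < m) {β δ : ℝ}
    {A : En n → ℝ} {DA : (Fin n → ℕ) → En n → ℝ} {K : En n → En n → ℝ} {CK : ℝ}
    (hK1 : ∀ x y : En n, x ≠ y → |K x y| ≤ CK * ‖x - y‖ ^ (δ - n))
    {G : Set (En n)} (hG : ∀ᵐ x, x ∈ G) {S : ℝ} (hS : 0 ≤ S)
    (hR : ∀ x ∈ G, ∀ y ∈ G, |Rm (m + 1) A DA x y| ≤ S * (‖x - y‖ ^ β * ‖x - y‖ ^ m))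
    (f : En n → ℝ) (x : En n) (hx : x ∈ G) :
    ‖TA m A DA K f x‖ₑ ≤ ENNReal.ofReal (S * |CK|) *
      ∫⁻ y, ENNReal.ofReal (‖x - y‖ ^ (β + δ - n) * |f y|) := by
  unfold TA
  refine (enorm_integral_le_lintegral_enorm _).trans ?_
  rw [← lintegral_const_mul' _ _ ENNReal.ofReal_ne_top]
  refine lintegral_mono_ae ?_
  filter_upwards [hG] with y hy
  rw [← ENNReal.ofReal_mul (by positivity), ← ofReal_norm]
  apply ENNReal.ofReal_le_ofReal
  rw [Real.norm_eq_abs, abs_mul, abs_mul, abs_div]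
  by_cases hxy : x = y
  · subst hxy
    simp [hm.ne']
    positivity
  · have hpos : 0 < ‖x - y‖ := norm_pos_iff.2 (sub_ne_zero.2 hxy)
    have h1 : |Rm (m + 1) A DA x y| / |‖x - y‖ ^ m| ≤ S * ‖x - y‖ ^ β := by
      rw [abs_of_pos (pow_pos hpos m), div_le_iff₀ (pow_pos hpos m)]
      have := hR x hx y hy
      linarith
    have h2 : |K x y| ≤ |CK| * ‖x - y‖ ^ (δ - n) :=
      (hK1 x y hxy).trans (mul_le_mul_of_nonneg_right (le_abs_self _) (by positivity))
    have e : ‖x - y‖ ^ (β + δ - n) = ‖x - y‖ ^ β * ‖x - y‖ ^ (δ - n) := by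
      rw [← Real.rpow_add hpos]; congr 1; ring
    calc _ ≤ (S * ‖x - y‖ ^ β) * ((|CK| * ‖x - y‖ ^ (δ - n)) * |f y|) := by gcongr
      _ = _ := by rw [e]; ring

lemma NiceFun.memLp {n : ℕ} {f : En n → ℝ} (hf : NiceFun f) (p : ℝ≥0∞) : MemLp f p volume := by
  obtain ⟨h1, h2, M, hM⟩ := hf
  exact h2.memLp_of_bound h1.aestronglyMeasurable M (Filter.Eventually.of_forall hM)

/-- `L^p → L^q` bound, Lipschitz case.
`‖T^A f‖_{L^q} ≤ C Σ_{|α|=m} ‖D^α A‖_{Lip_β} ‖f‖_{L^p}` with `1/q = 1/p − (β+δ)/n`. -/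
theorem stmt17 {n m : ℕ} (hn : 0 < n) (hm : 0 < m)
    (β δ ε p q : ℝ) (hβ0 : 0 < β) (hβ1 : β ≤ 1) (hδ0 : 0 ≤ δ) (hδn : δ < n) (hε : 0 < ε)
    (hβδn : β + δ < n)
    (hp1 : 1 < p) (hpn : (β + δ) * p < n) (hq : 1 / q = 1 / p - (β + δ) / n)
    (A : En n → ℝ) (DA : (Fin n → ℕ) → En n → ℝ)
    (hA : LocallyIntegrable A volume)
    (hDA : ∀ α : Fin n → ℕ, (∑ i, α i) ≤ m →
      IsWeakDeriv α A (DA α) ∧ LocallyIntegrable (DA α) volume)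
    (K : En n → En n → ℝ) (hKmeas : Measurable (Function.uncurry K)) (CK : ℝ)
    (hK1 : ∀ x y : En n, x ≠ y → |K x y| ≤ CK * ‖x - y‖ ^ (δ - n))
    (hK2 : ∀ x y z : En n, 2 * ‖y - z‖ ≤ ‖x - z‖ →
      |K y x - K z x| ≤ CK * ‖y - z‖ ^ ε * ‖x - z‖ ^ (δ - n - ε))
    -- `T` is bounded from `L^r` to `L^s` for all `1 < r < n/δ`, `1/s = 1/r − δ/n`
    (hT : ∀ r s : ℝ, 1 < r → δ * r < n → 1 / s = 1 / r - δ / n →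
      ∃ C : ℝ, ∀ f : En n → ℝ, NiceFun f →
        eLpNorm (Tint K f) (ENNReal.ofReal s) volume ≤
          ENNReal.ofReal C * eLpNorm f (ENNReal.ofReal r) volume) :
    ∃ C : ℝ, ∀ L : (Fin n → ℕ) → ℝ,
      -- `L α` bounds the `Lip_β` norm of `D^α A` for each `|α| = m`
      (∀ α ∈ Finset.Nat.antidiagonalTuple n m, LipBound β (DA α) (L α)) →
      ∀ f : En n → ℝ, NiceFun f →
        eLpNorm (TA m A DA K f) (ENNReal.ofReal q) volume ≤
          ENNReal.ofReal (C * ∑ α ∈ Finset.Nat.antidiagonalTuple n m, L α) *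
            eLpNorm f (ENNReal.ofReal p) volume := by
  obtain ⟨C, hC0, hC⟩ := HLS hn (add_pos_of_pos_of_nonneg hβ0 hδ0) hβδn hp1 hpn hq
  obtain ⟨G, hG, hGR⟩ := taylor_ae hβ0 hA hDA
  have hp0 : 0 < p := by linarith
  have hn' : (0 : ℝ) < n := by exact_mod_cast hn
  have hq0 : 0 < q := by
    have : 0 < 1 / q := by
      rw [hq, sub_pos, div_lt_div_iff₀ hn' hp0]; linarith
    exact one_div_pos.1 this
  refine ⟨m.factorial * |CK| * C ^ (1 / q), fun L hL f hf => ?_⟩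
  have hL0 : ∀ α ∈ Finset.Nat.antidiagonalTuple n m, 0 ≤ L α :=
    fun α hα => LipBound_nonneg hn (hL α hα)
  have hS := Finset.sum_nonneg hL0
  set S := ∑ α ∈ Finset.Nat.antidiagonalTuple n m, L α with hSdef
  have hR := hGR L hL0 hL
  have hpt := TA_pointwise (f := f) hm hK1 hG (S := m.factorial * S) (by positivity) hR
  have hmem := hf.memLp (ENNReal.ofReal p)
  obtain ⟨M, hM⟩ := hf.2.2
  have hen : ∀ x, ENNReal.ofReal |f x| = ‖f x‖ₑ := fun x => by
    rw [← Real.norm_eq_abs, ofReal_norm]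
  have hpt0 : ENNReal.ofReal p ≠ 0 := by simpa using hp0
  have hqt0 : ENNReal.ofReal q ≠ 0 := by simpa using hq0
  have hnf : eLpNorm f (ENNReal.ofReal p) volume = (∫⁻ x, ENNReal.ofReal |f x| ^ p) ^ (1 / p) := by
    rw [eLpNorm_eq_lintegral_rpow_enorm_toReal hpt0 ENNReal.ofReal_ne_top,
      ENNReal.toReal_ofReal hp0.le]
    simp only [hen]
  have hfin : ∫⁻ x, ENNReal.ofReal |f x| ^ p ≠ ⊤ := by
    intro h
    have := hmem.2.ne
    rw [hnf, h, ENNReal.top_rpow_of_pos (by positivity)] at this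
    exact this rfl
  have hIntg : Integrable (fun x => |f x|) volume :=
    ((memLp_one_iff_integrable).1 (hf.memLp 1)).abs
  have key := hC (fun x => |f x|) M hf.1.abs (fun x => abs_nonneg _) hM hIntg hfin
  rw [eLpNorm_eq_lintegral_rpow_enorm_toReal hqt0 ENNReal.ofReal_ne_top,
      ENNReal.toReal_ofReal hq0.le, hnf]
  have hb : ∫⁻ x, ‖TA m A DA K f x‖ₑ ^ q ≤ ENNReal.ofReal (m.factorial * S * |CK|) ^ q *
      (ENNReal.ofReal C * (∫⁻ x, ENNReal.ofReal |f x| ^ p) ^ (q / p)) := by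
    refine le_trans ?_ (mul_le_mul_right key _)
    rw [← lintegral_const_mul' _ _ (ENNReal.rpow_ne_top_of_nonneg hq0.le ENNReal.ofReal_ne_top)]
    refine lintegral_mono_ae ?_
    filter_upwards [hG] with x hx
    rw [← ENNReal.mul_rpow_of_nonneg _ _ hq0.le]
    exact ENNReal.rpow_le_rpow (hpt x hx) hq0.le
  have hq1 : 0 ≤ 1 / q := by positivity
  refine (ENNReal.rpow_le_rpow hb hq1).trans ?_
  rw [ENNReal.mul_rpow_of_nonneg _ _ hq1, ENNReal.mul_rpow_of_nonneg _ _ hq1, ← ENNReal.rpow_mul,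
    ← ENNReal.rpow_mul, mul_one_div_cancel hq0.ne', ENNReal.rpow_one,
    ENNReal.ofReal_rpow_of_nonneg hC0 hq1, ← mul_assoc, ← ENNReal.ofReal_mul (by positivity),
    show q / p * (1 / q) = 1 / p by field_simp]
  apply le_of_eq
  congr 2
  ring

end
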